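/- arXiv:math/0510372 — 2 statements merged into one kernel-verified Lean document; each statement's English description precedes it below -/
import Mathlib

section
/- Let S be a semigroup with a zero element 0 such that the radical R(S) is a nilpotent semigroup of class k, and let T ⊆ S be a nilpotent subsemigroup of class m. Then the subsemigroup generated by R(S) and T equals R(S) ∪ T, and R(S) ∪ T is a nilpotent subsemigroup of S of nilpotency class at most mk. -/
/-! Basic notions for nilpotent subsemigroups of a semigroup with zero,
following Ganyushkin–Mazorchuk, "On classification of maximal nilpotent
subsemigroups". -/

/-- The product `a * l₀ * l₁ * ⋯` of a nonempty list of semigroup elements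
(the element `a` followed by the elements of the list `l`). -/
def prodl {S : Type*} [Mul S] (a : S) (l : List S) : S := l.foldl (· * ·) a

/-- `T` is a subsemigroup of `S`, i.e. closed under multiplication. -/
def IsSubsgp {S : Type*} [Mul S] (T : Set S) : Prop :=
  ∀ ⦃a b : S⦄, a ∈ T → b ∈ T → a * b ∈ T

/-- Every product of `k` elements of `T` equals `0`. -/
def ProdZero {S : Type*} [Mul S] [Zero S] (T : Set S) (k : ℕ) : Prop :=
  ∀ (a : S) (l : List S), a ∈ T → (∀ x ∈ l, x ∈ T) → l.length + 1 = k →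
    prodl a l = 0

/-- `T` is a nilpotent subsemigroup: it is closed under multiplication and some
positive power of it vanishes. -/
def IsNilpSubsgp {S : Type*} [Mul S] [Zero S] (T : Set S) : Prop :=
  IsSubsgp T ∧ ∃ k : ℕ, 1 ≤ k ∧ ProdZero T k

/-- `k` is the nilpotency class of `T`: the least positive integer such that
every product of `k` elements of `T` equals `0`. -/
def NilpClass {S : Type*} [Mul S] [Zero S] (T : Set S) (k : ℕ) : Prop :=
  1 ≤ k ∧ ProdZero T k ∧ ∀ m : ℕ, 1 ≤ m → ProdZero T m → k ≤ m

/-- `T` is a maximal nilpotent subsemigroup of `S`: a maximal element of the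
set of nilpotent subsemigroups of `S` ordered by inclusion. -/
def IsMaxNilpSubsgp {S : Type*} [Mul S] [Zero S] (T : Set S) : Prop :=
  IsNilpSubsgp T ∧ ∀ T' : Set S, IsNilpSubsgp T' → T ⊆ T' → T' = T

/-- The principal left ideal `S¹a = {a} ∪ Sa`. -/
def lId {S : Type*} [Mul S] (a : S) : Set S := insert a {x | ∃ u, x = u * a}

/-- The principal right ideal `aS¹ = {a} ∪ aS`. -/
def rId {S : Type*} [Mul S] (a : S) : Set S := insert a {x | ∃ v, x = a * v}

/-- The principal two-sided ideal `(a) = S¹aS¹ = {a} ∪ Sa ∪ aS ∪ SaS`. -/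
def pId {S : Type*} [Mul S] (a : S) : Set S :=
  insert a ({x | ∃ u, x = u * a} ∪ {x | ∃ v, x = a * v} ∪ {x | ∃ u v, x = u * a * v})

/-- The radical `R(S)`: the set of `x ∈ S` such that the subsemigroup
`(x) = S¹xS¹` is nilpotent. -/
def radical (S : Type*) [Mul S] [Zero S] : Set S :=
  {x | ∃ k : ℕ, 1 ≤ k ∧ ProdZero (pId x) k}

/-- The J(=D for finite semigroups)-class of `a` is a minimal nonzero class:
`a ≠ 0` and every principal ideal contained in `(a)` is either `{0}` or equals
`(a)`. -/
def InMinClass {S : Type*} [Mul S] [Zero S] (a : S) : Prop :=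
  a ≠ 0 ∧ ∀ b : S, pId b ⊆ pId a → b = 0 ∨ pId b = pId a

/-- A minimal idempotent: a nonzero idempotent lying in a minimal D-class. -/
def MinIdem {S : Type*} [Mul S] [Zero S] (e : S) : Prop :=
  e * e = e ∧ InMinClass e

theorem prodl_mul {S : Type*} [Semigroup S] (a b : S) (l : List S) :
    prodl (a * b) l = a * prodl b l :=
  List.foldl_assoc

theorem prodl_append_cons {S : Type*} [Semigroup S] (a b : S) (l₁ l₂ : List S) :
    prodl a (l₁ ++ b :: l₂) = prodl a l₁ * prodl b l₂ := by
  rw [← prodl_mul]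
  simp [prodl]

theorem pId_mul_left_subset {S : Type*} [Semigroup S] (u x : S) : pId (u * x) ⊆ pId x := by
  rintro _ (rfl | (⟨v, rfl⟩ | ⟨v, rfl⟩) | ⟨v, w, rfl⟩)
  · exact .inr (.inl (.inl ⟨u, rfl⟩))
  · exact .inr (.inl (.inl ⟨v * u, (mul_assoc _ _ _).symm⟩))
  · exact .inr (.inr ⟨u, v, rfl⟩)
  · exact .inr (.inr ⟨v * u, w, by simp only [mul_assoc]⟩)

theorem pId_mul_right_subset {S : Type*} [Semigroup S] (x u : S) : pId (x * u) ⊆ pId x := by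
  rintro _ (rfl | (⟨v, rfl⟩ | ⟨v, rfl⟩) | ⟨v, w, rfl⟩)
  · exact .inr (.inl (.inr ⟨u, rfl⟩))
  · exact .inr (.inr ⟨v, u, (mul_assoc _ _ _).symm⟩)
  · exact .inr (.inl (.inr ⟨u * v, mul_assoc _ _ _⟩))
  · exact .inr (.inr ⟨v, u * w, by simp only [mul_assoc]⟩)

theorem ProdZero.mono {S : Type*} [Mul S] [Zero S] {A B : Set S} {k : ℕ}
    (hB : ProdZero B k) (h : A ⊆ B) : ProdZero A k :=
  fun a l ha hl => hB a l (h ha) fun x hx => h (hl x hx)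

theorem mul_mem_radical_left {S : Type*} [SemigroupWithZero S] {x : S}
    (hx : x ∈ radical S) (u : S) : u * x ∈ radical S :=
  hx.imp fun _ h => ⟨h.1, h.2.mono (pId_mul_left_subset u x)⟩

theorem mul_mem_radical_right {S : Type*} [SemigroupWithZero S] {x : S}
    (hx : x ∈ radical S) (u : S) : x * u ∈ radical S :=
  hx.imp fun _ h => ⟨h.1, h.2.mono (pId_mul_right_subset x u)⟩

theorem zero_mem_radical {S : Type*} [SemigroupWithZero S] : (0 : S) ∈ radical S := by
  refine ⟨1, le_rfl, fun a l ha _ hlen => ?_⟩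
  obtain rfl : l = [] := by simpa using hlen
  simpa [pId, prodl] using ha

theorem prodl_mem_radical_of_mem {S : Type*} [SemigroupWithZero S] {a : S}
    (ha : a ∈ radical S) (l : List S) : prodl a l ∈ radical S := by
  induction l generalizing a with
  | nil => exact ha
  | cons b l ih => exact ih (mul_mem_radical_right ha b)

theorem prodl_mem_radical_of_exists_mem {S : Type*} [SemigroupWithZero S] (a : S) {l : List S}
    (h : ∃ x ∈ l, x ∈ radical S) : prodl a l ∈ radical S := by
  obtain ⟨x, hx, hxR⟩ := h
  obtain ⟨l₁, l₂, rfl⟩ := List.append_of_mem hx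
  rw [prodl_append_cons]
  exact mul_mem_radical_left (prodl_mem_radical_of_mem hxR l₂) _

theorem prodl_mem_radical {S : Type*} [SemigroupWithZero S] {T : Set S} {m : ℕ}
    (hT : ProdZero T m) {a : S} {l : List S} (ha : a ∈ radical S ∪ T)
    (hl : ∀ x ∈ l, x ∈ radical S ∪ T) (hlen : l.length + 1 = m) : prodl a l ∈ radical S := by
  by_cases haR : a ∈ radical S
  · exact prodl_mem_radical_of_mem haR l
  by_cases hlR : ∃ x ∈ l, x ∈ radical S
  · exact prodl_mem_radical_of_exists_mem a hlR
  push Not at hlR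
  rw [hT a l (ha.resolve_left haR) (fun x hx => (hl x hx).resolve_left (hlR x hx)) hlen]
  exact zero_mem_radical

/-- If every product of `m` elements of `A` lies in `I`, then every product of `m * (k + 1)`
elements of `A` is a product of `k + 1` elements of `I`. -/
theorem exists_prodl_eq_of_length_eq_mul {S : Type*} [Semigroup S] {A I : Set S} {m : ℕ}
    (hm : 1 ≤ m)
    (hI : ∀ (a : S) (l : List S), a ∈ A → (∀ x ∈ l, x ∈ A) → l.length + 1 = m → prodl a l ∈ I)
    (k : ℕ) {a : S} {l : List S} (ha : a ∈ A) (hl : ∀ x ∈ l, x ∈ A)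
    (hlen : l.length + 1 = m * (k + 1)) :
    ∃ b l', b ∈ I ∧ (∀ x ∈ l', x ∈ I) ∧ l'.length = k ∧ prodl a l = prodl b l' := by
  induction k generalizing a l with
  | zero => exact ⟨prodl a l, [], hI a l ha hl (by simpa using hlen), by simp, rfl, rfl⟩
  | succ k ih =>
    have hmk : m ≤ m * (k + 1) := Nat.le_mul_of_pos_right m k.succ_pos
    have hlen' : l.length + 1 = m * (k + 1) + m := by rw [hlen]; ring
    have htake : (l.take (m - 1)).length + 1 = m := by rw [List.length_take]; omega
    have hdrop : (l.drop (m - 1)).length = m * (k + 1) := by rw [List.length_drop]; omega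
    obtain ⟨c, d, hcd⟩ := List.exists_cons_of_length_pos (l := l.drop (m - 1)) (by omega)
    have hmem : ∀ x ∈ c :: d, x ∈ A := fun x hx => hl x (List.mem_of_mem_drop (hcd ▸ hx))
    obtain ⟨b, l', hb, hl', hlen'', heq⟩ := ih (hmem c (by simp))
      (fun x hx => hmem x (List.mem_cons_of_mem c hx)) (by rw [← hdrop, hcd]; rfl)
    refine ⟨prodl a (l.take (m - 1)), b :: l',
      hI _ _ ha (fun x hx => hl x (List.mem_of_mem_take hx)) htake, ?_, by simp [hlen''], ?_⟩
    · simpa using ⟨hb, hl'⟩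
    · calc prodl a l = prodl a (l.take (m - 1) ++ c :: d) := by rw [← hcd, List.take_append_drop]
        _ = prodl (prodl a (l.take (m - 1))) (b :: l') := by
          rw [prodl_append_cons, heq, ← prodl_mul]
          rfl

theorem ProdZero.exists_nilpClass_le {S : Type*} [Mul S] [Zero S] {A : Set S} {n : ℕ}
    (hn : 1 ≤ n) (h : ProdZero A n) : ∃ c, NilpClass A c ∧ c ≤ n := by
  classical
  have hex : ∃ c, 1 ≤ c ∧ ProdZero A c := ⟨n, hn, h⟩
  exact ⟨Nat.find hex, ⟨(Nat.find_spec hex).1, (Nat.find_spec hex).2,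
    fun j hj hj' => Nat.find_min' hex ⟨hj, hj'⟩⟩, Nat.find_min' hex ⟨hn, h⟩⟩

/-- Let `S` be a semigroup with zero whose radical `R(S)` is a
nilpotent semigroup of class `k`, and let `T ⊆ S` be a nilpotent subsemigroup
of class `m`. Then the subsemigroup generated by `R(S)` and `T` equals
`R(S) ∪ T` (i.e. `R(S) ∪ T` is already closed under multiplication), and it is
a nilpotent subsemigroup of `S` of nilpotency class at most `m * k`. -/
theorem statement6 {S : Type*} [SemigroupWithZero S]
    (k m : ℕ) (hR : NilpClass (radical S) k)
    (T : Set S) (hT : IsSubsgp T) (hTm : NilpClass T m) :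
    IsSubsgp (radical S ∪ T) ∧
    ∃ c : ℕ, NilpClass (radical S ∪ T) c ∧ c ≤ m * k := by
  constructor
  · rintro a b (ha | ha) hb
    · exact .inl (mul_mem_radical_right ha b)
    rcases hb with hb | hb
    · exact .inl (mul_mem_radical_left hb a)
    · exact .inr (hT ha hb)
  obtain ⟨hk, hRk, -⟩ := hR
  obtain ⟨hm, hTm, -⟩ := hTm
  refine ProdZero.exists_nilpClass_le (Nat.mul_pos hm hk) fun a l ha hl hlen => ?_
  obtain ⟨k, rfl⟩ := Nat.exists_eq_add_of_le' hk
  obtain ⟨b, l', hb, hl', hlen', heq⟩ := exists_prodl_eq_of_length_eq_mul hm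
    (fun _ _ => prodl_mem_radical hTm) k ha hl hlen
  rw [heq]
  exact hRk b l' hb hl' (by rw [hlen'])
end

section
/- Let S be a finite semigroup with a zero element 0 such that R(S) = {0}, and let e, f be minimal idempotents of S whose D-classes are different, i.e., (e) ≠ (f). Then ef = 0 and exf = 0 for every x ∈ S. -/
theorem mem_pId_mul_left {S : Type*} [Semigroup S] {a b : S} (u : S) (h : b ∈ pId a) :
    u * b ∈ pId a := by
  rcases h with rfl | (⟨w, rfl⟩ | ⟨v, rfl⟩) | ⟨w, v, rfl⟩
  · exact Or.inr (Or.inl (Or.inl ⟨u, rfl⟩))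
  · exact Or.inr (Or.inl (Or.inl ⟨u * w, by simp only [mul_assoc]⟩))
  · exact Or.inr (Or.inr ⟨u, v, by simp only [mul_assoc]⟩)
  · exact Or.inr (Or.inr ⟨u * w, v, by simp only [mul_assoc]⟩)

theorem mem_pId_mul_right {S : Type*} [Semigroup S] {a b : S} (v : S) (h : b ∈ pId a) :
    b * v ∈ pId a := by
  rcases h with rfl | (⟨u, rfl⟩ | ⟨w, rfl⟩) | ⟨u, w, rfl⟩
  · exact Or.inr (Or.inl (Or.inr ⟨v, rfl⟩))
  · exact Or.inr (Or.inr ⟨u, v, rfl⟩)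
  · exact Or.inr (Or.inl (Or.inr ⟨w * v, by simp only [mul_assoc]⟩))
  · exact Or.inr (Or.inr ⟨u, w * v, by simp only [mul_assoc]⟩)

theorem pId_subset_of_mem {S : Type*} [Semigroup S] {a b : S} (h : b ∈ pId a) :
    pId b ⊆ pId a := by
  rintro _ (rfl | (⟨u, rfl⟩ | ⟨v, rfl⟩) | ⟨u, v, rfl⟩)
  · exact h
  · exact mem_pId_mul_left u h
  · exact mem_pId_mul_right v h
  · exact mem_pId_mul_right v (mem_pId_mul_left u h)

theorem self_mem_pId {S : Type*} [Mul S] (a : S) : a ∈ pId a := Or.inl rfl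

/-- Two distinct minimal nonzero classes generate ideals that meet only in `0`. -/
theorem InMinClass.eq_zero_of_mem_of_mem {S : Type*} [SemigroupWithZero S] {e f b : S}
    (he : InMinClass e) (hf : InMinClass f) (hne : pId e ≠ pId f)
    (hbe : b ∈ pId e) (hbf : b ∈ pId f) : b = 0 := by
  rcases he.2 b (pId_subset_of_mem hbe) with h | h
  · exact h
  rcases hf.2 b (pId_subset_of_mem hbf) with h' | h'
  · exact h'
  exact absurd (h.symm.trans h') hne

/-- Let `S` be a finite semigroup with zero with `R(S) = {0}`
and let `e, f` be minimal idempotents in different D-classes, i.e.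
`(e) ≠ (f)`. Then `e * f = 0` and `e * x * f = 0` for every `x ∈ S`. -/
theorem statement8 {S : Type*} [SemigroupWithZero S] [Finite S]
    (hrad : radical S = {0}) (e f : S) (he : MinIdem e) (hf : MinIdem f)
    (hne : pId e ≠ pId f) :
    e * f = 0 ∧ ∀ x : S, e * x * f = 0 := by
  have key : ∀ y : S, y ∈ pId e → y * f = 0 := fun y hy =>
    he.2.eq_zero_of_mem_of_mem hf.2 hne (mem_pId_mul_right f hy)
      (mem_pId_mul_left y (self_mem_pId f))
  exact ⟨key e (self_mem_pId e), fun x => key _ (mem_pId_mul_right x (self_mem_pId e))⟩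
end
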